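/- arXiv:1212.4056 — 3 statements merged into one kernel-verified Lean document; each statement's English description precedes it below -/
import Mathlib

section
/- Let Γ₁ and Γ₂ be finite-index subgroups of SL(2,ℤ). Then the set {u ∈ ℍ : there exist c ∈ Γ₁ and d ∈ Γ₂ such that c·d ≠ I, c·d ≠ −I, and (c·d)•u = u} is a finite union of orbits under Γ₁ ∩ Γ₂; that is, there is a finite subset F ⊆ ℍ such that this set equals {δ•z : δ ∈ Γ₁ ∩ Γ₂, z ∈ F}. -/
open Matrix

/-- The real and imaginary parts of a fixed point `z` of `g = (a, b; c, d)` with `g ≠ ± 1` satisfy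
`c ≠ 0`, `a - d = 2 c Re z` and `|c z + d| = 1`. -/
lemma fixed_point_equations (g : Matrix.SpecialLinearGroup (Fin 2) ℤ) (z : UpperHalfPlane)
    (hg : g • z = z) (h₁ : (g : Matrix (Fin 2) (Fin 2) ℤ) ≠ 1)
    (h₂ : (g : Matrix (Fin 2) (Fin 2) ℤ) ≠ -1) :
    g 1 0 ≠ 0 ∧ (g 0 0 : ℝ) - g 1 1 = 2 * g 1 0 * z.re ∧
      (g 1 0 * z.re + g 1 1) ^ 2 + (g 1 0 * z.im) ^ 2 = (1 : ℝ) := by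
  have hdet : g 0 0 * g 1 1 - g 0 1 * g 1 0 = 1 := by
    rw [← Matrix.det_fin_two]; exact g.det_coe
  have hdetR : (g 0 0 : ℝ) * g 1 1 - g 0 1 * g 1 0 = 1 := by exact_mod_cast hdet
  have hy := z.im_pos
  have hfix : ((g 0 0 : ℂ) * z + g 0 1) = z * (g 1 0 * z + g 1 1) := by
    have h := congrArg UpperHalfPlane.coe hg
    rw [UpperHalfPlane.specialLinearGroup_apply] at h
    have hne : ((g 1 0 : ℂ) * z + g 1 1) ≠ 0 := by
      simpa [UpperHalfPlane.denom] using UpperHalfPlane.denom_ne_zero g z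
    simpa [div_eq_iff hne] using h
  have hre := congrArg Complex.re hfix
  have him := congrArg Complex.im hfix
  simp at hre him
  have key : (g 0 0 : ℝ) - g 1 1 = 2 * g 1 0 * z.re := by
    apply mul_right_cancel₀ hy.ne'
    linarith
  refine ⟨fun hc => ?_, key, ?_⟩
  · have had : g 0 0 = g 1 1 := by
      simp only [hc, Int.cast_zero, mul_zero, zero_mul] at key
      exact_mod_cast sub_eq_zero.mp key
    have hb : g 0 1 = 0 := by
      simp [hc, had] at hre
      have : (g 0 1 : ℝ) = 0 := by linarith
      exact_mod_cast this
    rw [hc, ← had, mul_zero, sub_zero] at hdet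
    rcases mul_self_eq_one_iff.mp hdet with h | h
    · apply h₁; ext i j; fin_cases i <;> fin_cases j <;> simp [hc, hb, ← had, h]
    · apply h₂; ext i j; fin_cases i <;> fin_cases j <;> simp [hc, hb, ← had, h]
  · have ha : (g 0 0 : ℝ) = g 1 1 + 2 * g 1 0 * z.re := by linarith
    rw [ha] at hre hdetR
    linear_combination hdetR + (g 1 0 : ℝ) * hre

/-- A point of the upper half-plane is determined by the lower row and the upper left entry of an
elliptic matrix fixing it. -/
lemma subsingleton_fixed_point_equations (a c d : ℤ) :
    {z : UpperHalfPlane | c ≠ 0 ∧ (a : ℝ) - d = 2 * c * z.re ∧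
      (c * z.re + d) ^ 2 + (c * z.im) ^ 2 = (1 : ℝ)}.Subsingleton := by
  rintro z ⟨hc, hz, hz'⟩ w ⟨-, hw, hw'⟩
  have hc' : (c : ℝ) ≠ 0 := by exact_mod_cast hc
  have hre : z.re = w.re :=
    mul_left_cancel₀ (mul_ne_zero two_ne_zero hc') (hz.symm.trans hw)
  refine UpperHalfPlane.ext_re_im hre ?_
  rw [hre] at hz'
  have h : (c : ℝ) ^ 2 * z.im ^ 2 = (c : ℝ) ^ 2 * w.im ^ 2 := by linarith
  exact (pow_left_inj₀ z.im_pos.le w.im_pos.le two_ne_zero).mp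
    (mul_left_cancel₀ (pow_ne_zero 2 hc') h)

/-- The standard fundamental domain contains only finitely many elliptic points. -/
lemma finite_elliptic_points_fd :
    {z : UpperHalfPlane | z ∈ ModularGroup.fd ∧
      ∃ g : Matrix.SpecialLinearGroup (Fin 2) ℤ, (g : Matrix (Fin 2) (Fin 2) ℤ) ≠ 1 ∧
        (g : Matrix (Fin 2) (Fin 2) ℤ) ≠ -1 ∧ g • z = z}.Finite := by
  have hfin : (⋃ p ∈ (Set.Icc (-2) 2 ×ˢ Set.Icc (-2) 2 ×ˢ Set.Icc (-2) 2 : Set (ℤ × ℤ × ℤ)),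
      {z : UpperHalfPlane | p.2.1 ≠ 0 ∧ (p.1 : ℝ) - p.2.2 = 2 * p.2.1 * z.re ∧
        (p.2.1 * z.re + p.2.2) ^ 2 + (p.2.1 * z.im) ^ 2 = (1 : ℝ)}).Finite :=
    ((Set.finite_Icc _ _).prod ((Set.finite_Icc _ _).prod (Set.finite_Icc _ _))).biUnion
      fun p _ => (subsingleton_fixed_point_equations p.1 p.2.1 p.2.2).finite
  refine hfin.subset ?_
  rintro z ⟨hz, g, h₁, h₂, hg⟩
  obtain ⟨hc, had, hnorm⟩ := fixed_point_equations g z hg h₁ h₂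
  have him := ModularGroup.three_le_four_mul_im_sq_of_mem_fd hz
  obtain ⟨hx₁, hx₂⟩ := abs_le.mp hz.2
  have hcsq : (g 1 0 : ℝ) ^ 2 < 2 := by
    nlinarith [sq_nonneg (g 1 0 * z.re + g 1 1 : ℝ), sq_nonneg (g 1 0 : ℝ)]
  have hcsq' : (g 1 0) ^ 2 < 2 := by exact_mod_cast hcsq
  have hc₁ : -1 ≤ g 1 0 := by nlinarith
  have hc₂ : g 1 0 ≤ 1 := by nlinarith
  have hc₁' : (-1 : ℝ) ≤ g 1 0 := by exact_mod_cast hc₁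
  have hc₂' : (g 1 0 : ℝ) ≤ 1 := by exact_mod_cast hc₂
  obtain ⟨hcx₁, hcx₂⟩ : -(1 / 2) ≤ (g 1 0 : ℝ) * z.re ∧ (g 1 0 : ℝ) * z.re ≤ 1 / 2 := by
    constructor <;> nlinarith
  obtain ⟨hd₁, hd₂⟩ := abs_le.mp (abs_le_one_iff_mul_self_le_one.mpr
    (by nlinarith [sq_nonneg (g 1 0 * z.im : ℝ)] :
      (g 1 0 * z.re + g 1 1 : ℝ) * (g 1 0 * z.re + g 1 1) ≤ 1))
  have hd₁' : -2 < g 1 1 := by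
    have : (-2 : ℝ) < g 1 1 := by linarith
    exact_mod_cast this
  have hd₂' : g 1 1 < 2 := by
    have : (g 1 1 : ℝ) < 2 := by linarith
    exact_mod_cast this
  have ha₁ : -1 ≤ g 0 0 - g 1 1 := by
    have : (-1 : ℝ) ≤ g 0 0 - g 1 1 := by linarith
    exact_mod_cast this
  have ha₂ : g 0 0 - g 1 1 ≤ 1 := by
    have : (g 0 0 : ℝ) - g 1 1 ≤ 1 := by linarith
    exact_mod_cast this
  refine Set.mem_biUnion (x := (g 0 0, g 1 0, g 1 1)) ?_ ⟨hc, had, hnorm⟩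
  simp only [Set.mem_prod, Set.mem_Icc]
  lia

/-- An invariant set under a finite-index subgroup `H` of `G` which is covered by finitely many
`G`-orbits is a finite union of `H`-orbits. -/
lemma exists_finset_eq_orbits {G X : Type*} [Group G] [MulAction G X] (H : Subgroup G)
    [H.FiniteIndex] {S K : Set X} (hK : K.Finite) (hS : ∀ δ ∈ H, ∀ u ∈ S, δ • u ∈ S)
    (hcov : ∀ u ∈ S, ∃ g : G, g • u ∈ K) :
    ∃ F : Finset X, S = {w | ∃ δ ∈ H, ∃ z ∈ F, w = δ • z} := by
  have hfin : (S ∩ Set.image2 (fun (q : G ⧸ H) z => q.out⁻¹ • z) Set.univ K).Finite :=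
    (Set.finite_univ.image2 _ hK).inter_of_right _
  refine ⟨hfin.toFinset, Set.ext fun u => ⟨fun hu => ?_, ?_⟩⟩
  · obtain ⟨g, hg⟩ := hcov u hu
    obtain ⟨h, hh⟩ := QuotientGroup.mk_out_eq_mul H g
    have hmem : (h : G)⁻¹ • u = (g : G ⧸ H).out⁻¹ • g • u := by
      rw [hh, _root_.mul_inv_rev, mul_smul, inv_smul_smul]
    refine ⟨h, h.2, (h : G)⁻¹ • u, ?_, (smul_inv_smul _ _).symm⟩
    rw [Set.Finite.mem_toFinset]
    exact ⟨hS _ (H.inv_mem h.2) u hu, (g : G ⧸ H), Set.mem_univ _, g • u, hg, hmem.symm⟩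
  · rintro ⟨δ, hδ, z, hz, rfl⟩
    exact hS δ hδ z ((Set.Finite.mem_toFinset _).mp hz).1

/-- Conjugation preserves the matrices different from `1` and `-1`. -/
lemma conj_ne_one_and_ne_neg_one {g : Matrix.SpecialLinearGroup (Fin 2) ℤ}
    (h₁ : (g : Matrix (Fin 2) (Fin 2) ℤ) ≠ 1) (h₂ : (g : Matrix (Fin 2) (Fin 2) ℤ) ≠ -1)
    (δ : Matrix.SpecialLinearGroup (Fin 2) ℤ) :
    ((δ * g * δ⁻¹ : Matrix.SpecialLinearGroup (Fin 2) ℤ) : Matrix (Fin 2) (Fin 2) ℤ) ≠ 1 ∧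
      ((δ * g * δ⁻¹ : Matrix.SpecialLinearGroup (Fin 2) ℤ) : Matrix (Fin 2) (Fin 2) ℤ) ≠ -1 := by
  constructor
  · intro h
    have h' : δ * g * δ⁻¹ = 1 := Subtype.ext h
    apply h₁
    rw [conj_eq_one_iff.mp h', Matrix.SpecialLinearGroup.coe_one]
  · intro h
    have h' : δ * g * δ⁻¹ = -1 := Subtype.ext (by simpa using h)
    have hg : g = -1 := by
      have : g = δ⁻¹ * (δ * g * δ⁻¹) * δ := by group
      rw [this, h']; simp
    apply h₂
    rw [hg]; simp

/-- If `Γ₁, Γ₂` are finite-index subgroups of `SL(2, ℤ)`, then the set of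
points of the upper half-plane fixed by some element `c·d` (with `c ∈ Γ₁`, `d ∈ Γ₂`) which is
neither `I` nor `−I` is a finite union of orbits under `Γ₁ ∩ Γ₂`. -/
theorem stmt1 (Γ₁ Γ₂ : Subgroup (Matrix.SpecialLinearGroup (Fin 2) ℤ))
    (h₁ : Γ₁.FiniteIndex) (h₂ : Γ₂.FiniteIndex) :
    ∃ F : Finset UpperHalfPlane,
      {u : UpperHalfPlane | ∃ c ∈ Γ₁, ∃ d ∈ Γ₂,
          ((c * d : Matrix.SpecialLinearGroup (Fin 2) ℤ) : Matrix (Fin 2) (Fin 2) ℤ) ≠ 1 ∧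
          ((c * d : Matrix.SpecialLinearGroup (Fin 2) ℤ) : Matrix (Fin 2) (Fin 2) ℤ) ≠ -1 ∧
          (c * d) • u = u} =
      {w : UpperHalfPlane | ∃ δ ∈ Γ₁ ⊓ Γ₂, ∃ z ∈ F, w = δ • z} := by
  refine exists_finset_eq_orbits (Γ₁ ⊓ Γ₂) finite_elliptic_points_fd ?_ ?_
  · rintro δ ⟨hδ₁, hδ₂⟩ u ⟨c, hc, d, hd, hne, hne', hu⟩
    have hconj : (δ * c * δ⁻¹) * (δ * d * δ⁻¹) = δ * (c * d) * δ⁻¹ := by group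
    refine ⟨δ * c * δ⁻¹, Γ₁.mul_mem (Γ₁.mul_mem hδ₁ hc) (Γ₁.inv_mem hδ₁),
      δ * d * δ⁻¹, Γ₂.mul_mem (Γ₂.mul_mem hδ₂ hd) (Γ₂.inv_mem hδ₂), ?_⟩
    rw [hconj]
    obtain ⟨h, h'⟩ := conj_ne_one_and_ne_neg_one hne hne' δ
    exact ⟨h, h', by rw [mul_smul, inv_smul_smul, mul_smul, hu]⟩
  · rintro u ⟨c, -, d, -, hne, hne', hu⟩
    obtain ⟨g, hg⟩ := ModularGroup.exists_smul_mem_fd u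
    obtain ⟨h, h'⟩ := conj_ne_one_and_ne_neg_one hne hne' g
    exact ⟨g, hg, g * (c * d) * g⁻¹, h, h', by rw [mul_smul, inv_smul_smul, mul_smul, hu]⟩
end

section
/- Let p be a prime, let N ≥ 1 with p ∤ N, and let Γ be a subgroup of SL(2,ℤ) containing the principal congruence subgroup Γ(N). Let Γ' = Γ ∩ Γ⁰(p), where Γ⁰(p) = {g ∈ SL(2,ℤ) : p divides the upper-right entry of g}. Let α ∈ SL(2,ℚ) be a matrix all of whose entries have non-negative p-adic valuation. Then the double coset ΓαΓ is the union of exactly two double cosets of Γ': there exist α₁, α₂ ∈ SL(2,ℚ) with ΓαΓ = Γ'α₁Γ' ∪ Γ'α₂Γ' and Γ'α₁Γ' ∩ Γ'α₂Γ' = ∅. -/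
open Matrix

/-- The inclusion of `SL(2, ℤ)` into 2×2 rational matrices. -/
def toQ (γ : Matrix.SpecialLinearGroup (Fin 2) ℤ) : Matrix (Fin 2) (Fin 2) ℚ :=
  (γ : Matrix (Fin 2) (Fin 2) ℤ).map (fun a => (a : ℚ))

/-- The double coset `A·g·B` inside the rational 2×2 matrices. -/
def DCQ (A : Set (Matrix (Fin 2) (Fin 2) ℚ)) (g : Matrix (Fin 2) (Fin 2) ℚ)
    (B : Set (Matrix (Fin 2) (Fin 2) ℚ)) : Set (Matrix (Fin 2) (Fin 2) ℚ) :=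
  {m | ∃ a ∈ A, ∃ b ∈ B, m = a * g * b}

/-- An element of `SL(2, R)` given by its matrix. -/
def slMk {R : Type*} [CommRing R] (A : Matrix (Fin 2) (Fin 2) R) (h : A.det = 1) :
    SpecialLinearGroup (Fin 2) R := ⟨A, h⟩

@[simp]
theorem coe_slMk {R : Type*} [CommRing R] (A : Matrix (Fin 2) (Fin 2) R) (h : A.det = 1) :
    (slMk A h : Matrix (Fin 2) (Fin 2) R) = A := rfl

/-- A congruence subgroup of level prime to `p` surjects onto `SL(2, 𝔽_p)`. -/
theorem exists_mem_Gamma_map_eq {p : ℕ} [Fact p.Prime] {M : ℕ} (hM : ¬ p ∣ M)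
    (g : SpecialLinearGroup (Fin 2) (ZMod p)) :
    ∃ y ∈ CongruenceSubgroup.Gamma M,
      SpecialLinearGroup.map (Int.castRingHom (ZMod p)) y = g := by
  set H := (CongruenceSubgroup.Gamma M).map
    (SpecialLinearGroup.map (n := Fin 2) (Int.castRingHom (ZMod p)))
  have hM0 : (M : ZMod p) ≠ 0 := by rwa [Ne, ZMod.natCast_eq_zero_iff]
  have lift_scalar (t : ZMod p) : ∃ z : ℤ, ((M * z : ℤ) : ZMod p) = t := by
    obtain ⟨z, hz⟩ := ZMod.intCast_surjective ((M : ZMod p)⁻¹ * t)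
    exact ⟨z, by push_cast; rw [hz]; field_simp⟩
  have upper_mem (t : ZMod p) :
      slMk !![1, t; 0, 1] (by simp [det_fin_two]) ∈ H := by
    obtain ⟨z, rfl⟩ := lift_scalar t
    refine ⟨slMk !![1, M * z; 0, 1] (by simp [det_fin_two]), ?_, ?_⟩
    · simp [CongruenceSubgroup.Gamma_mem]
    · ext i j; fin_cases i <;> fin_cases j <;> simp
  have lower_mem (t : ZMod p) :
      slMk !![1, 0; t, 1] (by simp [det_fin_two]) ∈ H := by
    obtain ⟨z, rfl⟩ := lift_scalar t
    refine ⟨slMk !![1, 0; M * z, 1] (by simp [det_fin_two]), ?_, ?_⟩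
    · simp [CongruenceSubgroup.Gamma_mem]
    · ext i j; fin_cases i <;> fin_cases j <;> simp
  have mem_of_ne_zero (g : SpecialLinearGroup (Fin 2) (ZMod p)) (hc : g 1 0 ≠ 0) : g ∈ H := by
    have hd : g 0 0 * g 1 1 - g 0 1 * g 1 0 = 1 := by rw [← det_fin_two]; exact g.2
    convert H.mul_mem (H.mul_mem (upper_mem ((g 0 0 - 1) / g 1 0)) (lower_mem (g 1 0)))
      (upper_mem ((g 1 1 - 1) / g 1 0)) using 1
    ext i j
    fin_cases i <;> fin_cases j <;> simp [Matrix.mul_apply, Fin.sum_univ_two]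
    · field_simp; ring
    · field_simp; linear_combination -hd
    · field_simp; ring
  suffices h : g ∈ H by exact h
  by_cases hc : g 1 0 = 0
  · rw [← H.mul_mem_cancel_left (lower_mem 1)]
    apply mem_of_ne_zero
    have hd : g 0 0 * g 1 1 - g 0 1 * g 1 0 = 1 := by rw [← det_fin_two]; exact g.2
    have h0 : g 0 0 ≠ 0 := by rintro h; simp [h, hc] at hd
    simpa [Matrix.mul_apply, Fin.sum_univ_two, hc] using h0
  · exact mem_of_ne_zero g hc

/-- Two matrices lying in the same Bruhat cell have, up to a lower triangular factor of
determinant one on the left, proportional second columns. -/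
theorem exists_lowerTriangular_adjugate_mul_apply_eq_zero {F : Type*} [Field F]
    (B C : Matrix (Fin 2) (Fin 2) F) (h : B 0 1 = 0 ↔ C 0 1 = 0) :
    ∃ L : SpecialLinearGroup (Fin 2) F, L 0 1 = 0 ∧
      (C.adjugate * L.1.adjugate * B) 0 1 = 0 := by
  by_cases hB : B 0 1 = 0
  · refine ⟨1, by simp, ?_⟩
    simp [Matrix.mul_apply, Fin.sum_univ_two, adjugate_fin_two, hB, h.1 hB]
  · have hC : C 0 1 ≠ 0 := fun hC => hB (h.2 hC)
    have hdet : !![B 0 1 / C 0 1, 0;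
        (B 1 1 - C 0 1 * C 1 1 / B 0 1) / C 0 1, C 0 1 / B 0 1].det = 1 := by
      rw [det_fin_two_of]; field_simp; ring
    refine ⟨slMk _ hdet, by simp, ?_⟩
    simp [Matrix.mul_apply, Fin.sum_univ_two, adjugate_fin_two]
    field_simp
    ring

/-- Right multiplication by `SL(2, F)` moves an invertible matrix into the small Bruhat cell. -/
theorem exists_mul_apply_zero_one_eq_zero {F : Type*} [Field F]
    (A : Matrix (Fin 2) (Fin 2) F) (hA : A.det ≠ 0) :
    ∃ s : SpecialLinearGroup (Fin 2) F, (A * s.1) 0 1 = 0 := by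
  by_cases ha : A 0 0 = 0
  · have hb : A 0 1 ≠ 0 := by rintro hb; simp [det_fin_two, ha, hb] at hA
    exact ⟨slMk !![0, -A 0 1; (A 0 1)⁻¹, 0] (by simp [det_fin_two, hb]),
      by simp [Matrix.mul_apply, Fin.sum_univ_two, ha]⟩
  · exact ⟨slMk !![(A 0 0)⁻¹, -A 0 1; 0, A 0 0] (by simp [det_fin_two, ha]),
      by simp [Matrix.mul_apply, Fin.sum_univ_two]; ring⟩

/-- Right multiplication by `SL(2, F)` moves an invertible matrix into the big Bruhat cell. -/
theorem exists_mul_apply_zero_one_ne_zero {F : Type*} [Field F]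
    (A : Matrix (Fin 2) (Fin 2) F) (hA : A.det ≠ 0) :
    ∃ s : SpecialLinearGroup (Fin 2) F, (A * s.1) 0 1 ≠ 0 := by
  by_cases hb : A 0 1 = 0
  · have ha : A 0 0 ≠ 0 := by rintro ha; simp [det_fin_two, ha, hb] at hA
    exact ⟨slMk !![0, 1; -1, 0] (by simp [det_fin_two]),
      by simpa [Matrix.mul_apply, Fin.sum_univ_two] using ha⟩
  · exact ⟨1, by simpa using hb⟩

theorem Gamma_mul_le (N M : ℕ) :
    CongruenceSubgroup.Gamma (N * M) ≤ CongruenceSubgroup.Gamma N := by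
  intro y hy
  have key (a b : ℤ) (h : (a : ZMod (N * M)) = b) : (a : ZMod N) = b := by
    rw [ZMod.intCast_eq_intCast_iff_dvd_sub] at h ⊢
    exact (Int.natCast_dvd_natCast.2 (dvd_mul_right N M)).trans h
  rw [CongruenceSubgroup.Gamma_mem] at hy ⊢
  exact ⟨by simpa using key _ 1 (by simpa using hy.1),
    by simpa using key _ 0 (by simpa using hy.2.1),
    by simpa using key _ 0 (by simpa using hy.2.2.1),
    by simpa using key _ 1 (by simpa using hy.2.2.2)⟩

/-- An integral matrix `A` of determinant `D ^ 2` conjugates `Γ(N * D ^ 2)` into `Γ(N)`. -/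
theorem exists_mem_Gamma_mul_eq_mul {N D : ℕ} (hD : D ≠ 0) {A : Matrix (Fin 2) (Fin 2) ℤ}
    (hA : A.det = (D : ℤ) ^ 2) {y : SpecialLinearGroup (Fin 2) ℤ}
    (hy : y ∈ CongruenceSubgroup.Gamma (N * D ^ 2)) :
    ∃ x ∈ CongruenceSubgroup.Gamma N, y.1 * A = A * x.1 := by
  obtain ⟨Y, hY⟩ : ∃ Y : Matrix (Fin 2) (Fin 2) ℤ, y.1 = 1 + ((N : ℤ) * (D : ℤ) ^ 2) • Y := by
    rw [CongruenceSubgroup.Gamma_mem] at hy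
    have key (i j : Fin 2) : ((N : ℤ) * (D : ℤ) ^ 2) ∣ y.1 i j - (1 : Matrix _ _ ℤ) i j := by
      have : ((N * D ^ 2 : ℕ) : ℤ) ∣ y.1 i j - (1 : Matrix _ _ ℤ) i j := by
        obtain ⟨h00, h01, h10, h11⟩ := hy
        rw [← ZMod.intCast_zmod_eq_zero_iff_dvd, Int.cast_sub, sub_eq_zero]
        fin_cases i <;> fin_cases j <;> simpa
      simpa using this
    choose Y hY using key
    exact ⟨of Y, by ext i j; simp [← hY]⟩
  have hcomm : y.1 * A = A * (1 + (N : ℤ) • (A.adjugate * Y * A)) := by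
    rw [hY, add_mul, mul_add, mul_smul_comm, ← mul_assoc, ← mul_assoc, mul_adjugate, hA]
    simp only [one_mul, mul_one, smul_mul_assoc, smul_smul]
  have hdet : (1 + (N : ℤ) • (A.adjugate * Y * A)).det = 1 := by
    have := congrArg det hcomm
    rw [det_mul, det_mul, y.2, one_mul] at this
    have hA0 : A.det ≠ 0 := by rw [hA]; positivity
    exact (mul_eq_left₀ hA0).1 this.symm
  refine ⟨slMk _ hdet, ?_, hcomm⟩
  simp only [CongruenceSubgroup.Gamma_mem, coe_slMk, Matrix.add_apply, Matrix.smul_apply]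
  simp

/-- A rational matrix integral at `p` becomes integral after scaling by an integer prime to
`p`. -/
theorem exists_smul_eq_map_intCast {p : ℕ} (hp : p.Prime) (α : Matrix (Fin 2) (Fin 2) ℚ)
    (hint : ∀ i j : Fin 2, 0 ≤ padicValRat p (α i j)) :
    ∃ (D : ℕ) (A : Matrix (Fin 2) (Fin 2) ℤ), ¬ p ∣ D ∧
      A.map (Int.cast : ℤ → ℚ) = (D : ℚ) • α := by
  have : Fact p.Prime := ⟨hp⟩
  have hden (i j : Fin 2) : ¬ p ∣ (α i j).den := by
    intro h
    have hnum : ¬ (p : ℤ) ∣ (α i j).num := fun h' =>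
      hp.one_lt.ne' (Nat.dvd_one.1 ((α i j).reduced ▸ Nat.dvd_gcd (Int.natCast_dvd.1 h') h))
    have h1 := hint i j
    rw [padicValRat_def, padicValInt.eq_zero_of_not_dvd hnum] at h1
    have h2 := one_le_padicValNat_of_dvd (α i j).den_ne_zero h
    omega
  refine ⟨∏ i, ∏ j, (α i j).den,
    of fun i j => ((∏ i, ∏ j, (α i j).den : ℕ) / (α i j).den : ℕ) * (α i j).num, ?_, ?_⟩
  · simp only [Prime.dvd_finsetProd_iff hp.prime, hden, and_false, exists_false,
      not_false_eq_true]
  · ext i j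
    have hdvd : (α i j).den ∣ ∏ i, ∏ j, (α i j).den :=
      (Finset.dvd_prod_of_mem (fun j => (α i j).den) (Finset.mem_univ j)).trans
        (Finset.dvd_prod_of_mem (fun i => ∏ j, (α i j).den) (Finset.mem_univ i))
    have h0 : ((α i j).den : ℚ) ≠ 0 := by exact_mod_cast (α i j).den_ne_zero
    rw [map_apply, of_apply, Int.cast_mul, Int.cast_natCast, Nat.cast_div hdvd h0,
      Matrix.smul_apply, smul_eq_mul]
    conv_rhs => rw [← Rat.num_div_den (α i j)]
    ring

theorem toQ_mul (x y : SpecialLinearGroup (Fin 2) ℤ) : toQ (x * y) = toQ x * toQ y := by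
  ext i j; simp [toQ, Matrix.mul_apply]

theorem det_toQ (x : SpecialLinearGroup (Fin 2) ℤ) : (toQ x).det = 1 := by
  have := x.2
  rw [det_fin_two] at this ⊢
  simpa [toQ] using by exact_mod_cast this

/-- Reduction modulo `p` of integral matrices. -/
abbrev redMod (p : ℕ) : Matrix (Fin 2) (Fin 2) ℤ →+* Matrix (Fin 2) (Fin 2) (ZMod p) :=
  (Int.castRingHom (ZMod p)).mapMatrix

/-- With `Γ' = Γ ∩ Γ⁰(p)`, the double coset of `A * s` under `Γ'` contains every element of `ΓAΓ`
lying in the Bruhat cell of `A * s` modulo `p`. -/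
theorem exists_mul_eq_of_apply_zero_iff {p : ℕ} [Fact p.Prime] {N D : ℕ} (hpN : ¬ p ∣ N)
    (hpD : ¬ p ∣ D) {Γ : Subgroup (SpecialLinearGroup (Fin 2) ℤ)}
    (hΓ : CongruenceSubgroup.Gamma N ≤ Γ) {A : Matrix (Fin 2) (Fin 2) ℤ}
    (hA : A.det = (D : ℤ) ^ 2) {s γ₁ γ₂ : SpecialLinearGroup (Fin 2) ℤ} (hs : s ∈ Γ)
    (h₁ : γ₁ ∈ Γ) (h₂ : γ₂ ∈ Γ)
    (h : (p : ℤ) ∣ (γ₁.1 * A * γ₂.1) 0 1 ↔ (p : ℤ) ∣ (A * s.1) 0 1) :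
    ∃ b ∈ Γ, (p : ℤ) ∣ b.1 0 1 ∧ ∃ b' ∈ Γ, (p : ℤ) ∣ b'.1 0 1 ∧
      γ₁.1 * A * γ₂.1 = b.1 * (A * s.1) * b'.1 := by
  have hp : p.Prime := Fact.out
  have hD : D ≠ 0 := by rintro rfl; simp at hpD
  obtain ⟨L, hL, hLBC⟩ := exists_lowerTriangular_adjugate_mul_apply_eq_zero
    (redMod p (γ₁.1 * A * γ₂.1)) (redMod p (A * s.1))
    (by simpa only [RingHom.mapMatrix_apply, map_apply, eq_intCast,
      ZMod.intCast_zmod_eq_zero_iff_dvd] using h)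
  have hM : ¬ p ∣ N * D ^ 2 := fun h =>
    (hp.dvd_mul.1 h).elim hpN fun h => hpD (hp.dvd_of_dvd_pow h)
  obtain ⟨y, hy, hyL⟩ := exists_mem_Gamma_map_eq hM
    (L⁻¹ * SpecialLinearGroup.map (Int.castRingHom (ZMod p)) γ₁)
  obtain ⟨x, hx, hyx⟩ := exists_mem_Gamma_mul_eq_mul hD hA hy
  have hb : SpecialLinearGroup.map (Int.castRingHom (ZMod p)) (γ₁ * y⁻¹) = L := by
    rw [map_mul, map_inv, hyL]; group
  have hbL : redMod p (γ₁ * y⁻¹).1 = L.1 := congrArg Subtype.val hb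
  have hyΓ : y ∈ Γ := hΓ (Gamma_mul_le N _ hy)
  have heq : γ₁.1 * A * γ₂.1 = (γ₁ * y⁻¹).1 * (A * s.1) * (s⁻¹ * x * γ₂).1 := by
    have hs1 : s.1 * s⁻¹.1 = 1 := congrArg Subtype.val (mul_inv_cancel s)
    have hy1 : y⁻¹.1 * y.1 = 1 := congrArg Subtype.val (inv_mul_cancel y)
    calc γ₁.1 * A * γ₂.1 = γ₁.1 * (y⁻¹.1 * y.1) * A * γ₂.1 := by rw [hy1, mul_one]
      _ = γ₁.1 * y⁻¹.1 * (y.1 * A) * γ₂.1 := by simp only [mul_assoc]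
      _ = γ₁.1 * y⁻¹.1 * (A * (s.1 * s⁻¹.1) * x.1) * γ₂.1 := by rw [hyx, hs1, mul_one]
      _ = γ₁.1 * y⁻¹.1 * (A * s.1) * (s⁻¹.1 * x.1 * γ₂.1) := by simp only [mul_assoc]
  refine ⟨γ₁ * y⁻¹, Γ.mul_mem h₁ (Γ.inv_mem hyΓ), ?_, s⁻¹ * x * γ₂,
    Γ.mul_mem (Γ.mul_mem (Γ.inv_mem hs) (hΓ hx)) h₂, ?_, heq⟩
  · rw [← ZMod.intCast_zmod_eq_zero_iff_dvd, ← hL, ← hbL]; rfl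
  · have hred : redMod p (γ₁.1 * A * γ₂.1) =
        L.1 * redMod p (A * s.1) * redMod p (s⁻¹ * x * γ₂).1 := by
      rw [heq, ← hbL, ← map_mul, ← map_mul]
    rw [hred] at hLBC
    have hdet : (redMod p (A * s.1)).det = (D : ZMod p) ^ 2 := by
      rw [← RingHom.map_det, det_mul, hA, s.2]; simp
    have hadj : (redMod p (A * s.1)).adjugate * L.1.adjugate *
        (L.1 * redMod p (A * s.1) * redMod p (s⁻¹ * x * γ₂).1) =
        (D : ZMod p) ^ 2 • redMod p (s⁻¹ * x * γ₂).1 := by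
      set C := redMod p (A * s.1)
      set b' := redMod p (s⁻¹ * x * γ₂).1
      calc C.adjugate * L.1.adjugate * (L.1 * C * b')
          = C.adjugate * (L.1.adjugate * L.1) * C * b' := by simp only [mul_assoc]
        _ = _ := by
          rw [adjugate_mul, L.2, one_smul, mul_one, adjugate_mul, hdet, smul_mul, one_mul]
    rw [hadj, Matrix.smul_apply, smul_eq_mul] at hLBC
    have hD0 : (D : ZMod p) ^ 2 ≠ 0 := by
      apply pow_ne_zero; rwa [Ne, ZMod.natCast_eq_zero_iff]
    rw [← ZMod.intCast_zmod_eq_zero_iff_dvd]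
    exact (mul_eq_zero.1 hLBC).resolve_left hD0

/-- Multiplication on both sides by elements of `Γ⁰(p)` preserves the Bruhat cells mod `p`. -/
theorem dvd_mul_mul_apply_iff {p : ℕ} [Fact p.Prime] {b b' : SpecialLinearGroup (Fin 2) ℤ}
    (hb : (p : ℤ) ∣ b.1 0 1) (hb' : (p : ℤ) ∣ b'.1 0 1) (C : Matrix (Fin 2) (Fin 2) ℤ) :
    (p : ℤ) ∣ (b.1 * C * b'.1) 0 1 ↔ (p : ℤ) ∣ C 0 1 := by
  have hd := b.2
  have hd' := b'.2
  rw [det_fin_two] at hd hd'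
  simp only [← ZMod.intCast_zmod_eq_zero_iff_dvd] at hb hb' ⊢
  replace hd := congrArg (Int.cast : ℤ → ZMod p) hd
  replace hd' := congrArg (Int.cast : ℤ → ZMod p) hd'
  push_cast at hd hd'
  simp only [hb, hb', zero_mul, sub_zero] at hd hd'
  have h0 : ((b.1 0 0 : ℤ) : ZMod p) ≠ 0 := left_ne_zero_of_mul (hd.trans_ne one_ne_zero)
  have h1 : ((b'.1 1 1 : ℤ) : ZMod p) ≠ 0 := right_ne_zero_of_mul (hd'.trans_ne one_ne_zero)
  simp [hb, hb', h0, h1, Matrix.mul_apply, Fin.sum_univ_two]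

/-- Let `Γ` be a subgroup of `SL(2,ℤ)` containing `Γ(N)` with `p ∤ N`, and
let `Γ' = Γ ∩ Γ⁰(p)`.  For `α ∈ SL(2,ℚ)` which is integral at `p`, the double coset `ΓαΓ`
is the disjoint union of exactly two double cosets of `Γ'`. -/
theorem stmt4 (p : ℕ) (hp : p.Prime) (N : ℕ) (hN : 1 ≤ N) (hpN : ¬ p ∣ N)
    (Γ : Subgroup (Matrix.SpecialLinearGroup (Fin 2) ℤ))
    (hΓ : CongruenceSubgroup.Gamma N ≤ Γ)
    (α : Matrix (Fin 2) (Fin 2) ℚ) (hdet : α.det = 1)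
    (hint : ∀ i j : Fin 2, 0 ≤ padicValRat p (α i j)) :
    ∃ α₁ α₂ : Matrix (Fin 2) (Fin 2) ℚ, α₁.det = 1 ∧ α₂.det = 1 ∧
      DCQ {m | ∃ γ ∈ Γ, m = toQ γ} α {m | ∃ γ ∈ Γ, m = toQ γ} =
        DCQ {m | ∃ γ ∈ Γ, (p : ℤ) ∣ (γ : Matrix (Fin 2) (Fin 2) ℤ) 0 1 ∧ m = toQ γ} α₁
            {m | ∃ γ ∈ Γ, (p : ℤ) ∣ (γ : Matrix (Fin 2) (Fin 2) ℤ) 0 1 ∧ m = toQ γ} ∪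
          DCQ {m | ∃ γ ∈ Γ, (p : ℤ) ∣ (γ : Matrix (Fin 2) (Fin 2) ℤ) 0 1 ∧ m = toQ γ} α₂
            {m | ∃ γ ∈ Γ, (p : ℤ) ∣ (γ : Matrix (Fin 2) (Fin 2) ℤ) 0 1 ∧ m = toQ γ} ∧
      Disjoint
        (DCQ {m | ∃ γ ∈ Γ, (p : ℤ) ∣ (γ : Matrix (Fin 2) (Fin 2) ℤ) 0 1 ∧ m = toQ γ} α₁
            {m | ∃ γ ∈ Γ, (p : ℤ) ∣ (γ : Matrix (Fin 2) (Fin 2) ℤ) 0 1 ∧ m = toQ γ})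
        (DCQ {m | ∃ γ ∈ Γ, (p : ℤ) ∣ (γ : Matrix (Fin 2) (Fin 2) ℤ) 0 1 ∧ m = toQ γ} α₂
            {m | ∃ γ ∈ Γ, (p : ℤ) ∣ (γ : Matrix (Fin 2) (Fin 2) ℤ) 0 1 ∧ m = toQ γ}) := by
  have : Fact p.Prime := ⟨hp⟩
  obtain ⟨D, A, hpD, hDA⟩ := exists_smul_eq_map_intCast hp α hint
  have hD : (D : ℚ) ≠ 0 := by
    rintro h; exact hpD (by rw [Nat.cast_eq_zero.1 h]; exact dvd_zero p)
  have hA : A.det = (D : ℤ) ^ 2 := by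
    have h : ((Int.castRingHom ℚ).mapMatrix A).det = (D : ℚ) ^ 2 := by
      have h' : (Int.castRingHom ℚ).mapMatrix A = (D : ℚ) • α := hDA
      rw [h', det_smul, hdet]; simp
    rw [← RingHom.map_det] at h
    rw [eq_intCast] at h
    exact_mod_cast h
  have scale (b A' b' : Matrix (Fin 2) (Fin 2) ℤ) :
      (b * A' * b').map (Int.cast : ℤ → ℚ) =
        b.map Int.cast * A'.map Int.cast * b'.map Int.cast := by
    ext i j; simp [Matrix.mul_apply]
  have scale_eq (b s b' : SpecialLinearGroup (Fin 2) ℤ) :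
      (b.1 * (A * s.1) * b'.1).map (Int.cast : ℤ → ℚ) =
        (D : ℚ) • (toQ b * (α * toQ s) * toQ b') := by
    rw [scale]
    have : (A * s.1).map (Int.cast : ℤ → ℚ) = (D : ℚ) • (α * toQ s) := by
      rw [← smul_mul, ← hDA]; ext i j; simp [Matrix.mul_apply, toQ]
    rw [this, mul_smul_comm, smul_mul_assoc]; rfl
  have hdetp : (redMod p A).det ≠ 0 := by
    rw [← RingHom.map_det, hA]
    simpa [ZMod.natCast_eq_zero_iff] using hpD
  have toQ_one : toQ 1 = 1 := by ext i j; fin_cases i <;> fin_cases j <;> simp [toQ]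
  have cell (s : SpecialLinearGroup (Fin 2) ℤ) :
      (p : ℤ) ∣ (A * s.1) 0 1 ↔
        (redMod p A * (SpecialLinearGroup.map (Int.castRingHom (ZMod p)) s).1) 0 1 = 0 := by
    rw [← ZMod.intCast_zmod_eq_zero_iff_dvd]
    simp [Matrix.mul_apply]
  obtain ⟨t₁, ht₁⟩ := exists_mul_apply_zero_one_eq_zero _ hdetp
  obtain ⟨t₂, ht₂⟩ := exists_mul_apply_zero_one_ne_zero _ hdetp
  obtain ⟨s₁, hs₁, rfl⟩ := exists_mem_Gamma_map_eq hpN t₁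
  obtain ⟨s₂, hs₂, rfl⟩ := exists_mem_Gamma_map_eq hpN t₂
  rw [← cell] at ht₁
  rw [Ne, ← cell] at ht₂
  have cancel {X Y : Matrix (Fin 2) (Fin 2) ℚ} (h : (D : ℚ) • X = (D : ℚ) • Y) : X = Y :=
    smul_right_injective _ hD h
  have intCast_inj {X Y : Matrix (Fin 2) (Fin 2) ℤ}
      (h : X.map (Int.cast : ℤ → ℚ) = Y.map Int.cast) : X = Y :=
    map_injective Int.cast_injective h
  refine ⟨α * toQ s₁, α * toQ s₂, by rw [det_mul, hdet, det_toQ, one_mul],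
    by rw [det_mul, hdet, det_toQ, one_mul], ?_, ?_⟩
  · ext m
    constructor
    · rintro ⟨_, ⟨γ₁, h₁, rfl⟩, _, ⟨γ₂, h₂, rfl⟩, rfl⟩
      have main (s : SpecialLinearGroup (Fin 2) ℤ) (hs : s ∈ CongruenceSubgroup.Gamma N)
          (h : (p : ℤ) ∣ (γ₁.1 * A * γ₂.1) 0 1 ↔ (p : ℤ) ∣ (A * s.1) 0 1) :
          toQ γ₁ * α * toQ γ₂ ∈ DCQ
            {m | ∃ γ ∈ Γ, (p : ℤ) ∣ (γ : Matrix (Fin 2) (Fin 2) ℤ) 0 1 ∧ m = toQ γ}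
            (α * toQ s)
            {m | ∃ γ ∈ Γ, (p : ℤ) ∣ (γ : Matrix (Fin 2) (Fin 2) ℤ) 0 1 ∧ m = toQ γ} := by
        obtain ⟨b, hb, hpb, b', hb', hpb', heq⟩ :=
          exists_mul_eq_of_apply_zero_iff hpN hpD hΓ hA (hΓ hs) h₁ h₂ h
        refine ⟨_, ⟨b, hb, hpb, rfl⟩, _, ⟨b', hb', hpb', rfl⟩, cancel ?_⟩
        rw [← scale_eq, ← heq]
        simpa [toQ_one] using (scale_eq γ₁ 1 γ₂).symm
      by_cases hcell : (p : ℤ) ∣ (γ₁.1 * A * γ₂.1) 0 1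
      · exact Or.inl (main s₁ hs₁ (iff_of_true hcell ht₁))
      · exact Or.inr (main s₂ hs₂ (iff_of_false hcell ht₂))
    · rintro (⟨_, ⟨b, hb, -, rfl⟩, _, ⟨b', hb', -, rfl⟩, rfl⟩ |
        ⟨_, ⟨b, hb, -, rfl⟩, _, ⟨b', hb', -, rfl⟩, rfl⟩)
      · exact ⟨_, ⟨b, hb, rfl⟩, _, ⟨s₁ * b', Γ.mul_mem (hΓ hs₁) hb', rfl⟩,
          by simp only [toQ_mul, mul_assoc]⟩
      · exact ⟨_, ⟨b, hb, rfl⟩, _, ⟨s₂ * b', Γ.mul_mem (hΓ hs₂) hb', rfl⟩,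
          by simp only [toQ_mul, mul_assoc]⟩
  · rw [Set.disjoint_left]
    rintro _ ⟨_, ⟨b, -, hb, rfl⟩, _, ⟨b', -, hb', rfl⟩, rfl⟩
      ⟨_, ⟨c, -, hc, rfl⟩, _, ⟨c', -, hc', rfl⟩, heq⟩
    have h : b.1 * (A * s₁.1) * b'.1 = c.1 * (A * s₂.1) * c'.1 :=
      intCast_inj (by rw [scale_eq, scale_eq, heq])
    refine ht₂ ((dvd_mul_mul_apply_iff hc hc' _).1 ?_)
    rw [← h]
    exact (dvd_mul_mul_apply_iff hb hb' _).2 ht₁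
end

section
/- Let p be an odd prime, let j, m ∈ ℚ_p have p-adic valuation 0, and let ξ ∈ ℤ_p be a unit which is not a square. Let U⁰(p²) = {g ∈ K : the upper-right entry of g has p-adic valuation ≥ 2}. Then K·(1, j/(mp); 0, 1)·K = K·diag(p⁻¹, p)·K, and this set is the disjoint union of the four sets K·(1, j/(mp); 0, 1)·U⁰(p²), K·(p⁻¹, 1; 0, p)·U⁰(p²), K·(p⁻¹, ξ; 0, p)·U⁰(p²), and K·(p⁻¹, 0; 0, p)·U⁰(p²). -/
open Matrix

/-- `K = SL(2, ℤ_p)`: determinant-one 2×2 matrices over `ℚ_p` with `p`-integral entries. -/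
def Kset (p : ℕ) [Fact p.Prime] : Set (Matrix (Fin 2) (Fin 2) ℚ_[p]) :=
  {g | g.det = 1 ∧ ∀ i j, ‖g i j‖ ≤ 1}

/-- `U⁰(p²) ⊆ K`: the upper-right entry has valuation ≥ 2. -/
def U0sq (p : ℕ) [Fact p.Prime] : Set (Matrix (Fin 2) (Fin 2) ℚ_[p]) :=
  {g | g ∈ Kset p ∧ ‖g 0 1‖ ≤ (((p : ℝ)) ^ 2)⁻¹}

/-- The double coset `A·g·B` of 2×2 matrices over `ℚ_p`. -/
def DCp (p : ℕ) [Fact p.Prime] (A : Set (Matrix (Fin 2) (Fin 2) ℚ_[p]))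
    (g : Matrix (Fin 2) (Fin 2) ℚ_[p]) (B : Set (Matrix (Fin 2) (Fin 2) ℚ_[p])) :
    Set (Matrix (Fin 2) (Fin 2) ℚ_[p]) :=
  {m | ∃ a ∈ A, ∃ b ∈ B, m = a * g * b}

/-- The four `(K, U⁰(p²))`-double coset representatives appearing in Statement 10. -/
noncomputable def w10 (p : ℕ) [Fact p.Prime] (j m ξ : ℚ_[p]) :
    Fin 4 → Matrix (Fin 2) (Fin 2) ℚ_[p] :=
  ![!![1, j / (m * (p : ℚ_[p])); 0, 1],
    !![((p : ℚ_[p]))⁻¹, 1; 0, (p : ℚ_[p])],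
    !![((p : ℚ_[p]))⁻¹, ξ; 0, (p : ℚ_[p])],
    !![((p : ℚ_[p]))⁻¹, 0; 0, (p : ℚ_[p])]]

section

variable {p : ℕ} [Fact p.Prime]

theorem Kset_mul_mem {A B : Matrix (Fin 2) (Fin 2) ℚ_[p]} (hA : A ∈ Kset p) (hB : B ∈ Kset p) :
    A * B ∈ Kset p := by
  refine ⟨by rw [det_mul, hA.1, hB.1, one_mul], fun i j => ?_⟩
  rw [← PadicInt.mem_subring_iff, mul_apply]
  exact sum_mem fun l _ => mul_mem (hA.2 i l) (hB.2 l j)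

theorem adjugate_mem_Kset {A : Matrix (Fin 2) (Fin 2) ℚ_[p]} (hA : A ∈ Kset p) :
    A.adjugate ∈ Kset p := by
  refine ⟨by rw [det_adjugate, hA.1, one_pow], fun i j => ?_⟩
  rw [adjugate_fin_two]
  fin_cases i <;> fin_cases j <;> simpa using hA.2 _ _

theorem adjugate_mul_of_mem_Kset {A : Matrix (Fin 2) (Fin 2) ℚ_[p]} (hA : A ∈ Kset p) :
    A.adjugate * A = 1 := by
  rw [adjugate_mul, hA.1, one_smul]

theorem mul_adjugate_of_mem_Kset {A : Matrix (Fin 2) (Fin 2) ℚ_[p]} (hA : A ∈ Kset p) :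
    A * A.adjugate = 1 := by
  rw [mul_adjugate, hA.1, one_smul]

theorem mk_mem_Kset {a b c d : ℚ_[p]} (hdet : a * d - b * c = 1) (ha : ‖a‖ ≤ 1) (hb : ‖b‖ ≤ 1)
    (hc : ‖c‖ ≤ 1) (hd : ‖d‖ ≤ 1) : !![a, b; c, d] ∈ Kset p := by
  refine ⟨by rw [det_fin_two_of, hdet], fun i j => ?_⟩
  fin_cases i <;> fin_cases j <;> simpa

theorem norm_le_inv_sq_iff {x : ℚ_[p]} :
    ‖x‖ ≤ ((p : ℝ) ^ 2)⁻¹ ↔ ∃ y : ℚ_[p], ‖y‖ ≤ 1 ∧ x = p ^ 2 * y := by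
  have hp : (p : ℚ_[p]) ≠ 0 := Nat.cast_ne_zero.2 (Fact.out : p.Prime).ne_zero
  have hp' : (0 : ℝ) < p := Nat.cast_pos.2 (Fact.out : p.Prime).pos
  constructor
  · intro h
    refine ⟨x / p ^ 2, ?_, by field_simp⟩
    rw [norm_div, norm_pow, Padic.norm_p, div_le_one (by positivity), inv_pow]
    exact h
  · rintro ⟨y, hy, rfl⟩
    rw [norm_mul, norm_pow, Padic.norm_p, inv_pow]
    exact mul_le_of_le_one_right (by positivity) hy

theorem norm_lt_one_iff_exists {x : ℚ_[p]} :
    ‖x‖ < 1 ↔ ∃ y : ℚ_[p], ‖y‖ ≤ 1 ∧ x = p * y := by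
  have hp : (p : ℚ_[p]) ≠ 0 := Nat.cast_ne_zero.2 (Fact.out : p.Prime).ne_zero
  have hp' : (0 : ℝ) < p := Nat.cast_pos.2 (Fact.out : p.Prime).pos
  constructor
  · intro h
    refine ⟨x / p, ?_, by field_simp⟩
    have h1 : ‖x‖ ≤ (p : ℝ) ^ (-1 : ℤ) := by
      rw [Padic.norm_le_pow_iff_norm_lt_pow_add_one]
      simpa using h
    rw [norm_div, Padic.norm_p, div_le_one (by positivity)]
    simpa using h1
  · rintro ⟨y, hy, rfl⟩
    rw [norm_mul]
    exact mul_lt_one_of_nonneg_of_lt_one_left (norm_nonneg _) Padic.norm_p_lt_one hy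

theorem p_mul_ne_one {x : ℚ_[p]} (hx : ‖x‖ ≤ 1) : (p : ℚ_[p]) * x ≠ 1 := by
  intro h
  have := norm_lt_one_iff_exists.2 ⟨x, hx, rfl⟩
  rw [h, norm_one] at this
  exact lt_irrefl _ this

theorem U0sq_mul_mem {A B : Matrix (Fin 2) (Fin 2) ℚ_[p]} (hA : A ∈ U0sq p) (hB : B ∈ U0sq p) :
    A * B ∈ U0sq p := by
  refine ⟨Kset_mul_mem hA.1 hB.1, ?_⟩
  obtain ⟨y, hy, hAy⟩ := norm_le_inv_sq_iff.1 hA.2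
  obtain ⟨z, hz, hBz⟩ := norm_le_inv_sq_iff.1 hB.2
  refine norm_le_inv_sq_iff.2 ⟨A 0 0 * z + y * B 1 1, ?_, ?_⟩
  · exact add_mem (s := PadicInt.subring p) (mul_mem (hA.1.2 0 0) hz) (mul_mem hy (hB.1.2 1 1))
  · rw [mul_apply, Fin.sum_univ_two, hAy, hBz]
    ring

theorem adjugate_mem_U0sq {A : Matrix (Fin 2) (Fin 2) ℚ_[p]} (hA : A ∈ U0sq p) :
    A.adjugate ∈ U0sq p := by
  refine ⟨adjugate_mem_Kset hA.1, ?_⟩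
  rw [adjugate_fin_two]
  simpa using hA.2

theorem DCp_subset {w g k l : Matrix (Fin 2) (Fin 2) ℚ_[p]}
    {B : Set (Matrix (Fin 2) (Fin 2) ℚ_[p])}
    (hB : B ⊆ Kset p) (hk : k ∈ Kset p) (hl : l ∈ Kset p) (hg : g = k * w * l) :
    DCp p (Kset p) g B ⊆ DCp p (Kset p) w (Kset p) := by
  rintro _ ⟨a, ha, b, hb, rfl⟩
  exact ⟨a * k, Kset_mul_mem ha hk, l * b, Kset_mul_mem hl (hB hb), by
    simp only [hg, Matrix.mul_assoc]⟩

theorem DCp_Kset_eq {w g k l : Matrix (Fin 2) (Fin 2) ℚ_[p]}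
    (hk : k ∈ Kset p) (hl : l ∈ Kset p) (hg : g = k * w * l) :
    DCp p (Kset p) g (Kset p) = DCp p (Kset p) w (Kset p) := by
  refine (DCp_subset subset_rfl hk hl hg).antisymm
    (DCp_subset subset_rfl (adjugate_mem_Kset hk) (adjugate_mem_Kset hl) ?_)
  calc w = (k.adjugate * k) * w * (l * l.adjugate) := by
        rw [adjugate_mul_of_mem_Kset hk, mul_adjugate_of_mem_Kset hl, Matrix.one_mul,
          Matrix.mul_one]
    _ = k.adjugate * g * l.adjugate := by simp only [hg, Matrix.mul_assoc]

theorem disjoint_DCp {w w' : Matrix (Fin 2) (Fin 2) ℚ_[p]}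
    (h : ∀ k ∈ Kset p, ∀ b ∈ U0sq p, k * w ≠ w' * b) :
    Disjoint (DCp p (Kset p) w (U0sq p)) (DCp p (Kset p) w' (U0sq p)) := by
  rw [Set.disjoint_left]
  rintro _ ⟨a, ha, b, hb, rfl⟩ ⟨c, hc, d, hd, he⟩
  refine h (c.adjugate * a) (Kset_mul_mem (adjugate_mem_Kset hc) ha) (d * b.adjugate)
    (U0sq_mul_mem hd (adjugate_mem_U0sq hb)) ?_
  calc c.adjugate * a * w = c.adjugate * (a * w * b) * b.adjugate := by
        simp only [Matrix.mul_assoc, mul_adjugate_of_mem_Kset hb.1, Matrix.mul_one]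
    _ = (c.adjugate * c) * (w' * (d * b.adjugate)) := by rw [he]; simp only [Matrix.mul_assoc]
    _ = w' * (d * b.adjugate) := by rw [adjugate_mul_of_mem_Kset hc, Matrix.one_mul]

/-- Conjugation by `diag(p⁻¹, p)` carries `U⁰(p²)` into `K`. -/
theorem exists_diag_mul_eq {u : Matrix (Fin 2) (Fin 2) ℚ_[p]} (hu : u ∈ U0sq p) :
    ∃ t ∈ Kset p, !![(p : ℚ_[p])⁻¹, 0; 0, (p : ℚ_[p])] * u =
      t * !![(p : ℚ_[p])⁻¹, 0; 0, (p : ℚ_[p])] := by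
  have hp : (p : ℚ_[p]) ≠ 0 := Nat.cast_ne_zero.2 (Fact.out : p.Prime).ne_zero
  obtain ⟨y, hy, huy⟩ := norm_le_inv_sq_iff.1 hu.2
  have hdet := hu.1.1
  rw [det_fin_two, huy] at hdet
  refine ⟨!![u 0 0, y; p ^ 2 * u 1 0, u 1 1],
    mk_mem_Kset (by linear_combination hdet) (hu.1.2 _ _) hy ?_ (hu.1.2 _ _), ?_⟩
  · exact mul_mem (s := PadicInt.subring p) (pow_mem (natCast_mem _ p) 2) (hu.1.2 1 0)
  · rw [eta_fin_two u, huy]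
    ext i j
    fin_cases i <;> fin_cases j <;> simp [mul_apply, Fin.sum_univ_two] <;> field_simp

theorem mem_DCp_of_cross {w a x k l b : Matrix (Fin 2) (Fin 2) ℚ_[p]} (ha : a ∈ Kset p)
    (hx : x ∈ Kset p) (hk : k ∈ Kset p) (hl : l ∈ Kset p) (hb : b ∈ U0sq p)
    (hw : w = k * !![(p : ℚ_[p])⁻¹, 0; 0, (p : ℚ_[p])] * l)
    (h : ‖x 0 1 * (l * b) 0 0 - x 0 0 * (l * b) 0 1‖ ≤ ((p : ℝ) ^ 2)⁻¹) :
    a * !![(p : ℚ_[p])⁻¹, 0; 0, (p : ℚ_[p])] * x ∈ DCp p (Kset p) w (U0sq p) := by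
  have hlb := Kset_mul_mem hl hb.1
  obtain ⟨t, ht, hDt⟩ := exists_diag_mul_eq (u := x * (l * b).adjugate)
    ⟨Kset_mul_mem hx (adjugate_mem_Kset hlb), by
      rw [adjugate_fin_two, mul_apply, Fin.sum_univ_two]
      simp only [of_apply, cons_val', cons_val_zero, cons_val_one, cons_val_fin_one]
      convert h using 2
      ring⟩
  refine ⟨a * t * k.adjugate, Kset_mul_mem (Kset_mul_mem ha ht) (adjugate_mem_Kset hk), b, hb, ?_⟩
  set D := !![(p : ℚ_[p])⁻¹, 0; 0, (p : ℚ_[p])]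
  calc a * D * x = a * (D * (x * (l * b).adjugate)) * (l * b) := by
        simp only [Matrix.mul_assoc, adjugate_mul_of_mem_Kset hlb, Matrix.mul_one]
    _ = a * t * (k.adjugate * k) * D * (l * b) := by
        rw [hDt, adjugate_mul_of_mem_Kset hk]; simp only [Matrix.mul_assoc, Matrix.one_mul]
    _ = a * t * k.adjugate * w * b := by simp only [hw, Matrix.mul_assoc]

theorem unipotent_div_p_factor {u : ℚ_[p]} (hu : ‖u‖ = 1) :
    !![u, 0; (p : ℚ_[p]), u⁻¹] ∈ Kset p ∧ !![p / u, 1; -1, 0] ∈ Kset p ∧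
    !![1, u / p; 0, 1] = !![u, 0; (p : ℚ_[p]), u⁻¹] * !![(p : ℚ_[p])⁻¹, 0; 0, (p : ℚ_[p])] *
      !![p / u, 1; -1, 0] := by
  have hp : (p : ℚ_[p]) ≠ 0 := Nat.cast_ne_zero.2 (Fact.out : p.Prime).ne_zero
  have hu0 : u ≠ 0 := norm_ne_zero_iff.1 (by simp [hu])
  have hp1 : ‖(p : ℚ_[p])‖ ≤ 1 := Padic.norm_p_lt_one.le
  refine ⟨mk_mem_Kset (by field_simp; ring) hu.le (by simp) hp1 (by simp [hu]),
    mk_mem_Kset (by ring) (by rw [norm_div, hu, div_one]; exact hp1) (by simp) (by simp)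
      (by simp), ?_⟩
  ext i j
  fin_cases i <;> fin_cases j <;> simp [mul_apply, Fin.sum_univ_two] <;> field_simp
  ring

theorem diag_mul_unipotent (t : ℚ_[p]) :
    !![(p : ℚ_[p])⁻¹, t; 0, (p : ℚ_[p])] =
      1 * !![(p : ℚ_[p])⁻¹, 0; 0, (p : ℚ_[p])] * !![1, p * t; 0, 1] := by
  have hp : (p : ℚ_[p]) ≠ 0 := Nat.cast_ne_zero.2 (Fact.out : p.Prime).ne_zero
  ext i j
  fin_cases i <;> fin_cases j <;> simp [mul_apply, Fin.sum_univ_two, hp]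

theorem one_mem_Kset : (1 : Matrix (Fin 2) (Fin 2) ℚ_[p]) ∈ Kset p := by
  rw [one_fin_two]
  exact mk_mem_Kset (by ring) (by simp) (by simp) (by simp) (by simp)

theorem unipotent_mem_Kset {t : ℚ_[p]} (ht : ‖t‖ ≤ 1) : !![1, p * t; 0, 1] ∈ Kset p :=
  mk_mem_Kset (by ring) (by simp)
    (mul_mem (s := PadicInt.subring p) (natCast_mem _ p) ht) (by simp) (by simp)

theorem disjoint_DCp_unipotent {u t : ℚ_[p]} (hu : ‖u‖ = 1) (ht : ‖t‖ ≤ 1) :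
    Disjoint (DCp p (Kset p) !![1, u / p; 0, 1] (U0sq p))
      (DCp p (Kset p) !![(p : ℚ_[p])⁻¹, t; 0, (p : ℚ_[p])] (U0sq p)) := by
  have hp : (p : ℚ_[p]) ≠ 0 := Nat.cast_ne_zero.2 (Fact.out : p.Prime).ne_zero
  have hu0 : u ≠ 0 := norm_ne_zero_iff.1 (by simp [hu])
  have hui : ‖u⁻¹‖ ≤ 1 := by simp [hu]
  refine disjoint_DCp fun k hk b hb h => ?_
  obtain ⟨y, hy, hby⟩ := norm_le_inv_sq_iff.1 hb.2
  have h0 := congrFun₂ h 0 1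
  have h1 := congrFun₂ h 1 1
  simp [mul_apply, Fin.sum_univ_two, hby] at h0 h1
  have hdet := hk.1
  rw [det_fin_two] at hdet
  field_simp at h0 h1
  refine p_mul_ne_one (p := p) (x := u⁻¹ * ((p * y + t * b 1 1 - k 0 1) * k 1 1 -
    k 0 1 * (p * b 1 1 - k 1 1))) ?_ ?_
  · have hpm : (p : ℚ_[p]) ∈ PadicInt.subring p := natCast_mem _ p
    exact mul_mem (s := PadicInt.subring p) hui (sub_mem (mul_mem (sub_mem (add_mem
      (mul_mem hpm hy) (mul_mem ht (hb.1.2 _ _))) (hk.2 _ _)) (hk.2 _ _)) (mul_mem (hk.2 _ _)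
      (sub_mem (mul_mem hpm (hb.1.2 _ _)) (hk.2 _ _))))
  · field_simp
    linear_combination u * hdet - k 1 1 * h0 + k 0 1 * h1

theorem disjoint_DCp_diag {t : ℚ_[p]} (ht : ‖t‖ = 1) :
    Disjoint (DCp p (Kset p) !![(p : ℚ_[p])⁻¹, t; 0, (p : ℚ_[p])] (U0sq p))
      (DCp p (Kset p) !![(p : ℚ_[p])⁻¹, 0; 0, (p : ℚ_[p])] (U0sq p)) := by
  have hp : (p : ℚ_[p]) ≠ 0 := Nat.cast_ne_zero.2 (Fact.out : p.Prime).ne_zero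
  have ht0 : t ≠ 0 := norm_ne_zero_iff.1 (by simp [ht])
  have hti : ‖t⁻¹‖ ≤ 1 := by simp [ht]
  refine disjoint_DCp fun k hk b hb h => ?_
  obtain ⟨y, hy, hby⟩ := norm_le_inv_sq_iff.1 hb.2
  have h0 := congrFun₂ h 0 1
  have h1 := congrFun₂ h 1 1
  simp [mul_apply, Fin.sum_univ_two, hby] at h0 h1
  have hdet := hk.1
  rw [det_fin_two] at hdet
  field_simp at h0 h1
  refine p_mul_ne_one (p := p) (x := t⁻¹ * ((y - k 0 1) * k 1 1 -
    k 0 1 * (b 1 1 - k 1 1))) ?_ ?_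
  · exact mul_mem (s := PadicInt.subring p) hti (sub_mem (mul_mem (sub_mem hy (hk.2 _ _))
      (hk.2 _ _)) (mul_mem (hk.2 _ _) (sub_mem (hb.1.2 _ _) (hk.2 _ _))))
  · field_simp
    linear_combination t * hdet - k 1 1 * h0 + k 0 1 * h1

theorem PadicInt.isSquare_of_isSquare_toZMod (hp : Odd p) {z : ℤ_[p]} (hz : ‖z‖ = 1)
    (h : IsSquare (PadicInt.toZMod z)) : IsSquare z := by
  obtain ⟨r, hr⟩ := h
  obtain ⟨a, rfl⟩ := ZMod.ringHom_surjective (PadicInt.toZMod (p := p)) r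
  have hker : ‖a ^ 2 - z‖ < 1 := by
    rw [← PadicInt.mem_nonunits, ← IsLocalRing.mem_maximalIdeal, ← PadicInt.ker_toZMod,
      RingHom.mem_ker, map_sub, map_pow, hr]
    ring
  have ha2 : ‖a ^ 2‖ = 1 := by
    rw [← hz]
    refine PadicInt.norm_eq_of_norm_add_lt_right (z2 := -z) ?_ |>.trans (norm_neg z)
    rwa [norm_neg, hz, ← sub_eq_add_neg]
  have ha : ‖a‖ = 1 := by
    rw [norm_pow] at ha2
    exact (pow_eq_one_iff_of_nonneg (norm_nonneg a) two_ne_zero).1 ha2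
  have h2 : ‖(2 : ℤ_[p])‖ = 1 := by
    have := PadicInt.norm_natCast_eq_one_iff (p := p) (n := 2)
    rw [Nat.cast_ofNat] at this
    exact this.2 (Nat.coprime_two_right.2 hp)
  obtain ⟨c, hc, -⟩ := hensels_lemma (p := p) (R := ℤ_[p])
    (F := Polynomial.X ^ 2 - Polynomial.C z) (a := a)
    (by simpa [one_add_one_eq_two, ha, h2] using hker)
  refine ⟨c, ?_⟩
  simp at hc
  linear_combination -hc

theorem isSquare_of_norm_sq_sub_lt (hp : Odd p) {z a : ℚ_[p]} (hz : ‖z‖ = 1) (ha : ‖a‖ ≤ 1)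
    (h : ‖a ^ 2 - z‖ < 1) : ∃ c : ℚ_[p], ‖c‖ ≤ 1 ∧ c ^ 2 = z := by
  obtain ⟨z, rfl⟩ : ∃ z' : ℤ_[p], (z' : ℚ_[p]) = z := ⟨⟨z, hz.le⟩, rfl⟩
  obtain ⟨a, rfl⟩ : ∃ a' : ℤ_[p], (a' : ℚ_[p]) = a := ⟨⟨a, ha⟩, rfl⟩
  have hker : PadicInt.toZMod (a ^ 2 - z) = 0 := by
    rw [← RingHom.mem_ker, PadicInt.ker_toZMod, IsLocalRing.mem_maximalIdeal,
      PadicInt.mem_nonunits, PadicInt.norm_def]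
    exact_mod_cast h
  obtain ⟨c, rfl⟩ := PadicInt.isSquare_of_isSquare_toZMod hp hz ⟨PadicInt.toZMod a, by
    rw [map_sub, map_pow, sub_eq_zero] at hker
    rw [← hker, pow_two]⟩
  exact ⟨c, c.2, by push_cast; ring⟩

theorem exists_sq_or_mul_sq (hp : Odd p) {ξ v : ℚ_[p]} (hξ : ‖ξ‖ = 1) (hv : ‖v‖ = 1)
    (hξsq : ¬ ∃ c : ℚ_[p], ‖c‖ ≤ 1 ∧ c ^ 2 = ξ) :
    ∃ a : ℚ_[p], ‖a‖ = 1 ∧ (a ^ 2 = v ∨ a ^ 2 = ξ * v) := by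
  obtain ⟨ξ, rfl⟩ : ∃ z : ℤ_[p], (z : ℚ_[p]) = ξ := ⟨⟨ξ, hξ.le⟩, rfl⟩
  obtain ⟨v, rfl⟩ : ∃ z : ℤ_[p], (z : ℚ_[p]) = v := ⟨⟨v, hv.le⟩, rfl⟩
  have key {z : ℤ_[p]} (hz : ‖z‖ = 1) (h : IsSquare (PadicInt.toZMod z)) :
      ∃ a : ℚ_[p], ‖a‖ = 1 ∧ a ^ 2 = z := by
    obtain ⟨c, rfl⟩ := PadicInt.isSquare_of_isSquare_toZMod hp hz h
    refine ⟨c, ?_, by push_cast; ring⟩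
    rw [← pow_two, norm_pow] at hz
    exact (pow_eq_one_iff_of_nonneg (norm_nonneg _) two_ne_zero).1 hz
  by_cases h : IsSquare (PadicInt.toZMod v)
  · obtain ⟨a, ha, hav⟩ := key hv h
    exact ⟨a, ha, .inl hav⟩
  have hξ' : ¬ IsSquare (PadicInt.toZMod ξ) := fun h' => by
    obtain ⟨a, ha, haξ⟩ := key hξ h'
    exact hξsq ⟨a, ha.le, haξ⟩
  have hmul : IsSquare (PadicInt.toZMod (ξ * v)) := by
    by_contra hn
    rw [← quadraticChar_neg_one_iff_not_isSquare] at h hξ' hn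
    rw [map_mul, map_mul, h, hξ'] at hn
    norm_num at hn
  obtain ⟨a, ha, hav⟩ := key (z := ξ * v) (by
    rw [norm_mul, PadicInt.norm_def, hξ, PadicInt.norm_def, hv, one_mul]) hmul
  exact ⟨a, ha, .inr (by rw [hav, PadicInt.coe_mul])⟩

theorem disjoint_DCp_nonsquare (hp : Odd p) {ξ : ℚ_[p]} (hξ : ‖ξ‖ = 1)
    (hξsq : ¬ ∃ c : ℚ_[p], ‖c‖ ≤ 1 ∧ c ^ 2 = ξ) :
    Disjoint (DCp p (Kset p) !![(p : ℚ_[p])⁻¹, 1; 0, (p : ℚ_[p])] (U0sq p))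
      (DCp p (Kset p) !![(p : ℚ_[p])⁻¹, ξ; 0, (p : ℚ_[p])] (U0sq p)) := by
  have hp0 : (p : ℚ_[p]) ≠ 0 := Nat.cast_ne_zero.2 (Fact.out : p.Prime).ne_zero
  refine disjoint_DCp fun k hk b hb h => hξsq ?_
  obtain ⟨y, hy, hby⟩ := norm_le_inv_sq_iff.1 hb.2
  have h0 := congrFun₂ h 0 1
  have h2 := congrFun₂ h 0 0
  simp [mul_apply, Fin.sum_univ_two, hby] at h0 h2
  have hdet := hb.1.1
  rw [det_fin_two, hby] at hdet
  field_simp at h0 h2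
  refine isSquare_of_norm_sq_sub_lt hp hξ (hk.2 0 0) (norm_lt_one_iff_exists.2
    ⟨k 0 0 * (y - k 0 1) + ξ ^ 2 * b 1 0 * b 1 1 + ξ * p * y * b 1 0, ?_, ?_⟩)
  · have hpm : (p : ℚ_[p]) ∈ PadicInt.subring p := natCast_mem _ p
    have hξm : ξ ∈ PadicInt.subring p := hξ.le
    exact add_mem (s := PadicInt.subring p) (add_mem (mul_mem (hk.2 _ _) (sub_mem hy (hk.2 _ _)))
      (mul_mem (mul_mem (pow_mem hξm 2) (hb.1.2 _ _)) (hb.1.2 _ _)))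
      (mul_mem (mul_mem (mul_mem hξm hpm) hy) (hb.1.2 _ _))
  · linear_combination k 0 0 * h0 + ξ * b 1 1 * h2 + ξ * hdet

theorem mem_DCp_of_mem_DCp_diag (hp : Odd p) {u ξ : ℚ_[p]} (hu : ‖u‖ = 1) (hξ : ‖ξ‖ = 1)
    (hξsq : ¬ ∃ c : ℚ_[p], ‖c‖ ≤ 1 ∧ c ^ 2 = ξ) {g : Matrix (Fin 2) (Fin 2) ℚ_[p]}
    (hg : g ∈ DCp p (Kset p) !![(p : ℚ_[p])⁻¹, 0; 0, (p : ℚ_[p])] (Kset p)) :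
    g ∈ DCp p (Kset p) !![1, u / p; 0, 1] (U0sq p) ∨
      ∃ t : ℚ_[p], (t = 1 ∨ t = ξ ∨ t = 0) ∧
        g ∈ DCp p (Kset p) !![(p : ℚ_[p])⁻¹, t; 0, (p : ℚ_[p])] (U0sq p) := by
  have hp0 : (p : ℚ_[p]) ≠ 0 := Nat.cast_ne_zero.2 (Fact.out : p.Prime).ne_zero
  have hpm : (p : ℚ_[p]) ∈ PadicInt.subring p := natCast_mem _ p
  obtain ⟨k, hk, x, hx, rfl⟩ := hg
  have hdet := hx.1
  rw [det_fin_two] at hdet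
  rcases (hx.2 0 1).eq_or_lt with hy | hy
  · left
    obtain ⟨hl, hr, he⟩ := unipotent_div_p_factor hu
    have hy0 : x 0 1 ≠ 0 := norm_ne_zero_iff.1 (by simp [hy])
    refine mem_DCp_of_cross hk hx hl hr (b := !![1, 0; x 0 0 / x 0 1 - p / u, 1])
      ⟨mk_mem_Kset (by ring) (by simp) (by simp) ?_ (by simp), by simp⟩ he ?_
    · refine sub_mem (H := PadicInt.subring p) ?_ ?_
      · rw [PadicInt.mem_subring_iff, norm_div, hy, div_one]
        exact hx.2 0 0
      · rw [PadicInt.mem_subring_iff, norm_div, hu, div_one]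
        exact hpm
    · have : x 0 1 * (x 0 0 / x 0 1) - x 0 0 = 0 := by field_simp; ring
      simp [this]
  right
  obtain ⟨v, hv, hyv⟩ := norm_lt_one_iff_exists.1 hy
  have hx0 : ‖x 0 0‖ = 1 := by
    refine (hx.2 0 0).antisymm (not_lt.1 fun hlt => ?_)
    obtain ⟨s, hs, hxs⟩ := norm_lt_one_iff_exists.1 hlt
    refine p_mul_ne_one (p := p) (x := s * x 1 1 - v * x 1 0)
      (sub_mem (H := PadicInt.subring p) (mul_mem hs (hx.2 _ _)) (mul_mem hv (hx.2 _ _))) ?_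
    rw [hyv, hxs] at hdet
    linear_combination hdet
  have main {t a : ℚ_[p]} (ht : ‖t‖ ≤ 1) (ha : ‖a‖ = 1)
      (h : ‖x 0 1 * a - x 0 0 * (p * t * a⁻¹)‖ ≤ ((p : ℝ) ^ 2)⁻¹) :
      k * !![(p : ℚ_[p])⁻¹, 0; 0, (p : ℚ_[p])] * x ∈
        DCp p (Kset p) !![(p : ℚ_[p])⁻¹, t; 0, (p : ℚ_[p])] (U0sq p) := by
    have ha0 : a ≠ 0 := norm_ne_zero_iff.1 (by simp [ha])
    refine mem_DCp_of_cross hk hx one_mem_Kset (unipotent_mem_Kset ht) (b := !![a, 0; 0, a⁻¹])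
      ⟨mk_mem_Kset (by field_simp; ring) ha.le (by simp) (by simp) (by simp [ha]),
        by simp⟩ (diag_mul_unipotent t) ?_
    simpa using h
  rcases hv.eq_or_lt with hv1 | hv1
  · have hv0 : v ≠ 0 := norm_ne_zero_iff.1 (by simp [hv1])
    obtain ⟨a, ha, h⟩ := exists_sq_or_mul_sq hp hξ (v := x 0 0 / v)
      (by rw [norm_div, hx0, hv1, div_one]) hξsq
    have ha0 : a ≠ 0 := norm_ne_zero_iff.1 (by simp [ha])
    have hzero {t : ℚ_[p]} (h : a ^ 2 = t * (x 0 0 / v)) :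
        ‖x 0 1 * a - x 0 0 * (p * t * a⁻¹)‖ ≤ ((p : ℝ) ^ 2)⁻¹ := by
      have : x 0 1 * a - x 0 0 * (p * t * a⁻¹) = 0 := by
        rw [hyv]
        field_simp at h ⊢
        linear_combination p * h
      rw [this, norm_zero]
      positivity
    rcases h with h | h
    · exact ⟨1, .inl rfl, main (by simp) ha (hzero (by rw [h, one_mul]))⟩
    · exact ⟨ξ, .inr (.inl rfl), main hξ.le ha (hzero h)⟩
  · obtain ⟨s, hs, hvs⟩ := norm_lt_one_iff_exists.1 hv1
    refine ⟨0, .inr (.inr rfl), main (a := 1) (by simp) (by simp)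
      (norm_le_inv_sq_iff.2 ⟨s, hs, ?_⟩)⟩
    rw [hyv, hvs]
    ring

end

/-- For `p` odd, units `j, m ∈ ℚ_p`, and `ξ` a non-square unit of `ℤ_p`,
`K·(1, j/(mp); 0, 1)·K = K·diag(p⁻¹, p)·K`, and this set is the disjoint union of the four
sets `K·w·U⁰(p²)` with `w` one of the listed representatives. -/
theorem stmt10 (p : ℕ) [Fact p.Prime] (hp : Odd p) (j m : ℚ_[p])
    (hj : ‖j‖ = 1) (hm : ‖m‖ = 1) (ξ : ℚ_[p]) (hξ : ‖ξ‖ = 1)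
    (hξsq : ¬ ∃ c : ℚ_[p], ‖c‖ ≤ 1 ∧ c ^ 2 = ξ) :
    DCp p (Kset p) (!![1, j / (m * (p : ℚ_[p])); 0, 1]) (Kset p) =
        DCp p (Kset p) (!![((p : ℚ_[p]))⁻¹, 0; 0, (p : ℚ_[p])]) (Kset p) ∧
      DCp p (Kset p) (!![1, j / (m * (p : ℚ_[p])); 0, 1]) (Kset p) =
        (⋃ i : Fin 4, DCp p (Kset p) (w10 p j m ξ i) (U0sq p)) ∧
      ∀ i i' : Fin 4, i ≠ i' →
        Disjoint (DCp p (Kset p) (w10 p j m ξ i) (U0sq p))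
          (DCp p (Kset p) (w10 p j m ξ i') (U0sq p)) := by
  have hu : ‖j / m‖ = 1 := by rw [norm_div, hj, hm, div_one]
  have hjm : j / (m * (p : ℚ_[p])) = j / m / p := by rw [div_div]
  obtain ⟨hl, hr, he⟩ := unipotent_div_p_factor hu
  have hU : U0sq p ⊆ Kset p := fun _ h => h.1
  have hKD := DCp_Kset_eq hl hr he
  have hsub {t : ℚ_[p]} (ht : ‖t‖ ≤ 1) :
      DCp p (Kset p) !![(p : ℚ_[p])⁻¹, t; 0, (p : ℚ_[p])] (U0sq p) ⊆ _ :=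
    DCp_subset hU one_mem_Kset (unipotent_mem_Kset ht) (diag_mul_unipotent t)
  simp only [w10, hjm]
  refine ⟨hKD, ?_, ?_⟩
  · rw [hKD]
    refine Set.Subset.antisymm (fun g hg => ?_) (Set.iUnion_subset fun i => ?_)
    · rw [Set.mem_iUnion]
      obtain h | ⟨t, rfl | rfl | rfl, h⟩ := mem_DCp_of_mem_DCp_diag hp hu hξ hξsq hg
      · exact ⟨0, h⟩
      · exact ⟨1, h⟩
      · exact ⟨2, h⟩
      · exact ⟨3, h⟩
    · fin_cases i
      · exact DCp_subset hU hl hr he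
      · exact hsub (by simp)
      · exact hsub hξ.le
      · exact hsub (by simp)
  · have h01 := disjoint_DCp_unipotent hu (t := (1 : ℚ_[p])) (by simp)
    have h02 := disjoint_DCp_unipotent hu hξ.le
    have h03 := disjoint_DCp_unipotent hu (t := (0 : ℚ_[p])) (by simp)
    have h12 := disjoint_DCp_nonsquare hp hξ hξsq
    have h13 := disjoint_DCp_diag (p := p) (t := 1) (by simp)
    have h23 := disjoint_DCp_diag hξ
    intro i i' hii
    fin_cases i <;> fin_cases i'
    exacts [absurd rfl hii, h01, h02, h03, h01.symm, absurd rfl hii, h12, h13,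
      h02.symm, h12.symm, absurd rfl hii, h23, h03.symm, h13.symm, h23.symm, absurd rfl hii]
end
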